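/- Let n ≥ 1 and let μ be a Borel probability measure on ℝ^n. Let I(μ) = {g ∈ GL(n,ℝ) : g∗μ = μ} and J(μ) = {g ∈ GL(n,ℝ) : g·x = x for all x in the support of μ}. Then J(μ) is a normal subgroup of I(μ), and the quotient topological group I(μ)/J(μ) is compact. -/

import Mathlib

open MeasureTheory

/-- The support of a Borel measure: the smallest closed set whose complement is null,
realized as the intersection of all closed sets with null complement. -/
def measureSupport {X : Type*} [TopologicalSpace X] [MeasurableSpace X]
    (μ : Measure X) : Set X :=
  ⋂₀ {s : Set X | IsClosed s ∧ μ sᶜ = 0}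

lemma supp_null {n : ℕ} (μ : Measure (Fin n → ℝ)) : μ (measureSupport μ)ᶜ = 0 := by
  refine measure_mono_null (Set.compl_subset_compl.2 ?_) (Measure.measure_compl_support (μ := μ))
  rintro x hx s ⟨hs, h0⟩
  by_contra hxs
  have := (Measure.mem_support_iff_forall (μ := μ) (x := x)).1 hx sᶜ (hs.isOpen_compl.mem_nhds hxs)
  exact this.ne' h0

lemma supp_ae {n : ℕ} (μ : Measure (Fin n → ℝ)) : ∀ᵐ x ∂μ, x ∈ measureSupport μ :=
  supp_null μ

lemma supp_ball {n : ℕ} (μ : Measure (Fin n → ℝ)) {x : Fin n → ℝ} (hx : x ∈ measureSupport μ)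
    {δ : ℝ} (hδ : 0 < δ) : 0 < μ (Metric.ball x δ) := by
  by_contra h
  have h0 : μ (Metric.ball x δ) = 0 := by simpa using h
  have := hx (Metric.ball x δ)ᶜ ⟨Metric.isOpen_ball.isClosed_compl, by simpa using h0⟩
  exact this (Metric.mem_ball_self hδ)

lemma mulVec_cont {n : ℕ} (A : Matrix (Fin n) (Fin n) ℝ) :
    Continuous (fun v : Fin n → ℝ => A.mulVec v) :=
  Continuous.matrix_mulVec continuous_const continuous_id

lemma supp_inv {n : ℕ} (μ : Measure (Fin n → ℝ)) (A : Matrix (Fin n) (Fin n) ℝ)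
    (hA : Measure.map (fun v => A.mulVec v) μ = μ) {x : Fin n → ℝ} (hx : x ∈ measureSupport μ) :
    A.mulVec x ∈ measureSupport μ := by
  rintro s ⟨hs, h0⟩
  refine hx ((fun v => A.mulVec v) ⁻¹' s) ⟨hs.preimage (mulVec_cont A), ?_⟩
  rw [← hA, Measure.map_apply (mulVec_cont A).measurable hs.measurableSet.compl] at h0
  exact h0

lemma map_eq_of_agree {n : ℕ} (μ : Measure (Fin n → ℝ)) (A B : Matrix (Fin n) (Fin n) ℝ)
    (h : ∀ x ∈ measureSupport μ, A.mulVec x = B.mulVec x) :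
    Measure.map (fun v => A.mulVec v) μ = Measure.map (fun v => B.mulVec v) μ := by
  apply Measure.map_congr
  filter_upwards [supp_ae μ] with x hx using h x hx

lemma closed_inv {n : ℕ} (μ : Measure (Fin n → ℝ)) [IsProbabilityMeasure μ] :
    IsClosed {A : Matrix (Fin n) (Fin n) ℝ | Measure.map (fun v => A.mulVec v) μ = μ} := by
  have : {A : Matrix (Fin n) (Fin n) ℝ | Measure.map (fun v => A.mulVec v) μ = μ}
      = ⋂ f : BoundedContinuousFunction (Fin n → ℝ) ℝ,
        {A | ∫ x, f (A.mulVec x) ∂μ = ∫ x, f x ∂μ} := by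
    ext A
    simp only [Set.mem_ofPred_eq, Set.mem_iInter]
    have key : ∀ f : BoundedContinuousFunction (Fin n → ℝ) ℝ,
        ∫ x, f x ∂(Measure.map (fun v => A.mulVec v) μ) = ∫ x, f (A.mulVec x) ∂μ := fun f =>
      integral_map (mulVec_cont A).measurable.aemeasurable
        f.continuous.stronglyMeasurable.aestronglyMeasurable
    constructor
    · intro h f
      rw [← key, h]
    · intro h
      have : IsProbabilityMeasure (Measure.map (fun v => A.mulVec v) μ) :=
        Measure.isProbabilityMeasure_map (mulVec_cont A).measurable.aemeasurable
      apply ext_of_forall_integral_eq_of_IsFiniteMeasure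
      intro f
      rw [key, h]
  rw [this]
  refine isClosed_iInter fun f => isClosed_eq ?_ continuous_const
  have : FirstCountableTopology (Matrix (Fin n) (Fin n) ℝ) :=
    inferInstanceAs (FirstCountableTopology (Fin n → Fin n → ℝ))
  refine continuous_of_dominated (bound := fun _ => ‖f‖) ?_ ?_ (integrable_const _) ?_
  · intro A
    exact (f.continuous.comp (mulVec_cont A)).stronglyMeasurable.aestronglyMeasurable
  · intro A
    exact Filter.Eventually.of_forall fun x => f.norm_coe_le_norm _
  · refine Filter.Eventually.of_forall fun x => f.continuous.comp ?_
    exact Continuous.matrix_mulVec continuous_id continuous_const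

lemma exists_proj {n : ℕ} (W : Submodule ℝ (Fin n → ℝ)) : ∃ P : Matrix (Fin n) (Fin n) ℝ,
    (∀ x, P.mulVec x ∈ W) ∧ ∀ x ∈ W, P.mulVec x = x := by
  obtain ⟨p, hp⟩ := LinearMap.exists_extend (LinearMap.id : W →ₗ[ℝ] W)
  refine ⟨LinearMap.toMatrix' (W.subtype ∘ₗ p), fun x => ?_, fun x hx => ?_⟩
  · rw [LinearMap.toMatrix'_mulVec]
    simp
  · rw [LinearMap.toMatrix'_mulVec]
    have := LinearMap.congr_fun hp ⟨x, hx⟩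
    simp at this
    simp [this]

lemma mulVec_eq_sum {n : ℕ} (A : Matrix (Fin n) (Fin n) ℝ) (x : Fin n → ℝ) :
    A.mulVec x = ∑ j, x j • A.mulVec (Pi.single j 1) := by
  ext i
  simp [Matrix.mulVec, dotProduct, mul_comm]

/-- Size of `A` on the range of `P`. -/
noncomputable def sz {n : ℕ} (P A : Matrix (Fin n) (Fin n) ℝ) : ℝ :=
  ∑ j, ‖A.mulVec (P.mulVec (Pi.single j 1))‖

lemma norm_le_sz {n : ℕ} (P A : Matrix (Fin n) (Fin n) ℝ) (x : Fin n → ℝ)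
    (hx : P.mulVec x = x) : ‖A.mulVec x‖ ≤ ‖x‖ * sz P A := by
  have : A.mulVec x = ∑ j, x j • A.mulVec (P.mulVec (Pi.single j 1)) := by
    conv_lhs => rw [← hx, Matrix.mulVec_mulVec, mulVec_eq_sum]
    simp only [Matrix.mulVec_mulVec]
  rw [this, sz, Finset.mul_sum]
  refine (norm_sum_le _ _).trans (Finset.sum_le_sum fun j _ => ?_)
  rw [norm_smul]
  gcongr
  exact norm_le_pi_norm x j

lemma sz_nonneg {n : ℕ} (P A : Matrix (Fin n) (Fin n) ℝ) : 0 ≤ sz P A :=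
  Finset.sum_nonneg fun _ _ => norm_nonneg _

lemma supp_bound {n : ℕ} (μ : Measure (Fin n → ℝ)) [IsProbabilityMeasure μ]
    (P : Matrix (Fin n) (Fin n) ℝ)
    (hP : ∀ x ∈ Submodule.span ℝ (measureSupport μ), P.mulVec x = x)
    {w : Fin n → ℝ} (hw : w ∈ measureSupport μ) {ε : ℝ} (hε : 0 < ε) :
    ∃ C : ℝ, ∀ A : Matrix (Fin n) (Fin n) ℝ, Measure.map (fun v => A.mulVec v) μ = μ →
      ‖A.mulVec w‖ ≤ C + ε * sz P A := by
  have hb := supp_ball μ hw hε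
  have hlim : Filter.Tendsto (fun k : ℕ => μ (Metric.closedBall 0 (k : ℝ))ᶜ) Filter.atTop
      (nhds 0) := by
    have h := tendsto_measure_iInter_atTop (μ := μ)
      (s := fun k : ℕ => (Metric.closedBall (0 : Fin n → ℝ) (k : ℝ))ᶜ)
      (fun k => Metric.isClosed_closedBall.measurableSet.compl.nullMeasurableSet)
      (fun a b hab => Set.compl_subset_compl.2
        (Metric.closedBall_subset_closedBall (by exact_mod_cast hab)))
      ⟨0, measure_ne_top _ _⟩
    rwa [← Set.compl_iUnion, Metric.iUnion_closedBall_nat, Set.compl_univ, measure_empty] at h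
  obtain ⟨k, hk⟩ := (hlim.eventually (gt_mem_nhds hb)).exists
  refine ⟨k, fun A hA => ?_⟩
  have h1 : μ ((fun v => A.mulVec v) ⁻¹' (Metric.closedBall 0 (k : ℝ))ᶜ)
      < μ (Metric.ball w ε) := by
    rw [← Measure.map_apply (mulVec_cont A).measurable
      Metric.isClosed_closedBall.measurableSet.compl, hA]
    exact hk
  have h2 : ¬ (Metric.ball w ε ⊆
      ((fun v => A.mulVec v) ⁻¹' (Metric.closedBall 0 (k : ℝ))ᶜ) ∪ (measureSupport μ)ᶜ) := by
    intro hsub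
    have h3 := (measure_mono hsub).trans (measure_union_le (μ := μ) _ _)
    rw [supp_null, add_zero] at h3
    exact absurd h1 (not_lt.2 h3)
  obtain ⟨x, hx, hx'⟩ := Set.not_subset.1 h2
  simp only [Set.mem_union, not_or, Set.mem_compl_iff, not_not, Set.mem_preimage,
    mem_closedBall_zero_iff] at hx'
  obtain ⟨hxk, hxs⟩ := hx'
  have hd : ‖w - x‖ ≤ ε := by
    rw [← dist_eq_norm, dist_comm]
    exact (Metric.mem_ball.1 hx).le
  have e : A.mulVec w = A.mulVec x + A.mulVec (w - x) := by
    rw [← Matrix.mulVec_add]; simp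
  rw [e]
  refine (norm_add_le _ _).trans (add_le_add hxk ?_)
  refine (norm_le_sz P A (w - x) (hP _ (Submodule.sub_mem _ (Submodule.subset_span hw)
    (Submodule.subset_span hxs)))).trans ?_
  exact mul_le_mul_of_nonneg_right hd (sz_nonneg _ _)

lemma span_bound {n : ℕ} (μ : Measure (Fin n → ℝ)) [IsProbabilityMeasure μ]
    (P : Matrix (Fin n) (Fin n) ℝ)
    (hP : ∀ x ∈ Submodule.span ℝ (measureSupport μ), P.mulVec x = x)
    {w : Fin n → ℝ} (hw : w ∈ Submodule.span ℝ (measureSupport μ)) :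
    ∀ ε : ℝ, 0 < ε →
    ∃ C : ℝ, ∀ A : Matrix (Fin n) (Fin n) ℝ, Measure.map (fun v => A.mulVec v) μ = μ →
      ‖A.mulVec w‖ ≤ C + ε * sz P A := by
  induction hw using Submodule.span_induction with
  | mem x hx => exact fun ε hε => supp_bound μ P hP hx hε
  | zero =>
    intro ε hε
    refine ⟨0, fun A _ => ?_⟩
    have := sz_nonneg P A
    simp only [Matrix.mulVec_zero, norm_zero]
    positivity
  | add x y _ _ hx hy =>
    intro ε hε
    obtain ⟨C, hC⟩ := hx (ε / 2) (by positivity)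
    obtain ⟨D, hD⟩ := hy (ε / 2) (by positivity)
    refine ⟨C + D, fun A hA => ?_⟩
    rw [Matrix.mulVec_add]
    have := norm_add_le (A.mulVec x) (A.mulVec y)
    linarith [hC A hA, hD A hA]
  | smul a x _ hx =>
    intro ε hε
    have ha : 0 < |a| + 1 := by positivity
    obtain ⟨C, hC⟩ := hx (ε / (|a| + 1)) (by positivity)
    refine ⟨(|a| + 1) * C, fun A hA => ?_⟩
    rw [Matrix.mulVec_smul, norm_smul, Real.norm_eq_abs]
    calc |a| * ‖A.mulVec x‖ ≤ (|a| + 1) * ‖A.mulVec x‖ := by gcongr; linarith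
      _ ≤ (|a| + 1) * (C + ε / (|a| + 1) * sz P A) := by gcongr; exact hC A hA
      _ = _ := by field_simp

lemma sz_bound {n : ℕ} (hn : 1 ≤ n) (μ : Measure (Fin n → ℝ)) [IsProbabilityMeasure μ]
    (P : Matrix (Fin n) (Fin n) ℝ)
    (hP : ∀ x ∈ Submodule.span ℝ (measureSupport μ), P.mulVec x = x)
    (hP' : ∀ x, P.mulVec x ∈ Submodule.span ℝ (measureSupport μ)) :
    ∃ S : ℝ, ∀ A : Matrix (Fin n) (Fin n) ℝ, Measure.map (fun v => A.mulVec v) μ = μ →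
      sz P A ≤ S := by
  have hn' : (0 : ℝ) < n := by exact_mod_cast hn
  choose C hC using fun j : Fin n =>
    span_bound μ P hP (hP' (Pi.single j 1)) (1 / (2 * n)) (by positivity)
  refine ⟨2 * ∑ j, C j, fun A hA => ?_⟩
  have h : sz P A ≤ ∑ j, (C j + 1 / (2 * n) * sz P A) := Finset.sum_le_sum fun j _ => hC j A hA
  rw [Finset.sum_add_distrib, Finset.sum_const, Finset.card_univ, Fintype.card_fin,
    nsmul_eq_mul] at h
  have e : (n : ℝ) * (1 / (2 * n) * sz P A) = sz P A / 2 := by field_simp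
  linarith

lemma entry_bound {n : ℕ} (P A : Matrix (Fin n) (Fin n) ℝ) (S : ℝ) (hS : sz P A ≤ S)
    (hA : A * (1 - P) = 1 - P) (i j : Fin n) : |A i j| ≤ S + sz 1 (1 - P) := by
  have e : A.mulVec (Pi.single j 1) = A.mulVec (P.mulVec (Pi.single j 1))
      + (1 - P).mulVec ((1 : Matrix (Fin n) (Fin n) ℝ).mulVec (Pi.single j 1)) := by
    conv_rhs => rw [← hA]
    rw [Matrix.one_mulVec, Matrix.mulVec_mulVec, ← Matrix.add_mulVec]
    congr 1
    noncomm_ring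
  have h1 : |A i j| ≤ ‖A.mulVec (Pi.single j 1)‖ := by
    have := norm_le_pi_norm (A.mulVec (Pi.single j 1)) i
    simpa using this
  have h2 : ‖A.mulVec (P.mulVec (Pi.single j 1))‖ ≤ sz P A :=
    Finset.single_le_sum (f := fun j => ‖A.mulVec (P.mulVec (Pi.single j 1))‖)
      (fun _ _ => norm_nonneg _) (Finset.mem_univ j)
  have h3 : ‖(1 - P).mulVec ((1 : Matrix (Fin n) (Fin n) ℝ).mulVec (Pi.single j 1))‖
      ≤ sz 1 (1 - P) :=
    Finset.single_le_sum
      (f := fun j => ‖(1 - P).mulVec ((1 : Matrix (Fin n) (Fin n) ℝ).mulVec (Pi.single j 1))‖)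
      (fun _ _ => norm_nonneg _) (Finset.mem_univ j)
  rw [e] at h1
  exact h1.trans ((norm_add_le _ _).trans (by linarith))

lemma compact_GL {n : ℕ} (K : Set (Matrix.GeneralLinearGroup (Fin n) ℝ)) (hK : IsClosed K)
    (S : ℝ) (hS : ∀ g ∈ K, ∀ i j, |(g : Matrix (Fin n) (Fin n) ℝ) i j| ≤ S)
    (hS' : ∀ g ∈ K, ∀ i j, |((g⁻¹ : Matrix.GeneralLinearGroup (Fin n) ℝ) :
      Matrix (Fin n) (Fin n) ℝ) i j| ≤ S) : IsCompact K := by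
  let B : Set (Matrix (Fin n) (Fin n) ℝ) :=
    Set.pi Set.univ fun _ => Set.pi Set.univ fun _ => Set.Icc (-S) S
  have hB : IsCompact B :=
    isCompact_univ_pi fun _ => isCompact_univ_pi fun _ => isCompact_Icc
  have hBB : IsCompact (B ×ˢ (MulOpposite.unop ⁻¹' B)) :=
    hB.prod (MulOpposite.opHomeomorph.symm.isCompact_preimage.2 hB)
  have hc := (Units.isClosedEmbedding_embedProduct
    (α := Matrix (Fin n) (Fin n) ℝ)).isCompact_preimage hBB
  refine hc.of_isClosed_subset hK fun g hg => ?_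
  refine ⟨fun i _ j _ => abs_le.1 (hS g hg i j), fun i _ j _ => abs_le.1 (hS' g hg i j)⟩

theorem invariance_mod_fixing_compact (n : ℕ) (hn : 1 ≤ n)
    (μ : Measure (Fin n → ℝ)) [IsProbabilityMeasure μ]
    (I J : Subgroup (Matrix.GeneralLinearGroup (Fin n) ℝ))
    (hI : ∀ g : Matrix.GeneralLinearGroup (Fin n) ℝ,
      g ∈ I ↔ Measure.map (fun v => ((g : Matrix (Fin n) (Fin n) ℝ)).mulVec v) μ = μ)
    (hJ : ∀ g : Matrix.GeneralLinearGroup (Fin n) ℝ,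
      g ∈ J ↔ ∀ x ∈ measureSupport μ, ((g : Matrix (Fin n) (Fin n) ℝ)).mulVec x = x) :
    J ≤ I ∧ (J.subgroupOf I).Normal ∧ CompactSpace (↥I ⧸ J.subgroupOf I) := by
  refine ⟨fun g hg => ?_, ⟨?_⟩, ?_⟩
  · rw [hI]
    rw [hJ] at hg
    rw [map_eq_of_agree μ _ 1 (fun x hx => by rw [hg x hx, Matrix.one_mulVec])]
    simp
  · rintro ⟨j, hjI⟩ hj ⟨g, hg⟩
    rw [Subgroup.mem_subgroupOf] at hj ⊢
    simp only at hj ⊢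
    change g * j * g⁻¹ ∈ J
    rw [hJ] at hj ⊢
    intro x hx
    have h1 := supp_inv μ _ ((hI _).1 (I.inv_mem hg)) hx
    have h2 := hj _ h1
    rw [Units.val_mul, Units.val_mul, ← Matrix.mulVec_mulVec, ← Matrix.mulVec_mulVec, h2,
      Matrix.mulVec_mulVec, ← Units.val_mul, mul_inv_cancel, Units.val_one, Matrix.one_mulVec]
  · obtain ⟨P, hP', hP⟩ := exists_proj (Submodule.span ℝ (measureSupport μ))
    obtain ⟨S, hS⟩ := sz_bound hn μ P hP hP'
    have hPP : P * P = P := by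
      apply Matrix.mulVec_injective
      ext1 x
      rw [← Matrix.mulVec_mulVec, hP _ (hP' x)]
    have hspan : ∀ g ∈ I, ∀ x ∈ Submodule.span ℝ (measureSupport μ),
        (g : Matrix (Fin n) (Fin n) ℝ).mulVec x ∈ Submodule.span ℝ (measureSupport μ) := by
      intro g hg x hx
      have : Submodule.span ℝ (measureSupport μ) ≤ (Submodule.span ℝ (measureSupport μ)).comap
          (Matrix.mulVecLin (g : Matrix (Fin n) (Fin n) ℝ)) :=
        Submodule.span_le.2 fun y hy =>
          Submodule.subset_span (supp_inv μ _ ((hI g).1 hg) hy)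
      exact this hx
    have hPg : ∀ g ∈ I, P * ((g : Matrix (Fin n) (Fin n) ℝ) * P) = g * P := by
      intro g hg
      apply Matrix.mulVec_injective
      ext1 x
      rw [← Matrix.mulVec_mulVec, ← Matrix.mulVec_mulVec, hP _ (hspan g hg _ (hP' x))]
    have hmul : ∀ g ∈ I, ∀ h ∈ I, g * h = 1 →
        ((g : Matrix (Fin n) (Fin n) ℝ) * P + (1 - P)) * (h * P + (1 - P)) = 1 := by
      intro g hg h hh hgh
      have hgh' : (g : Matrix (Fin n) (Fin n) ℝ) * h = 1 := by
        rw [← Units.val_mul, hgh, Units.val_one]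
      have h1 := hPg h hh
      have e1 : (g : Matrix (Fin n) (Fin n) ℝ) * P * (h * P) = P := by
        rw [mul_assoc, h1, ← mul_assoc, hgh', one_mul]
      have e2 : (g : Matrix (Fin n) (Fin n) ℝ) * P * (1 - P) = 0 := by
        rw [mul_assoc, mul_sub, hPP, mul_one, sub_self, mul_zero]
      have e3 : (1 - P) * ((h : Matrix (Fin n) (Fin n) ℝ) * P) = 0 := by
        rw [sub_mul, h1, one_mul, sub_self]
      have e4 : (1 - P) * (1 - P) = 1 - P := by
        rw [mul_sub, sub_mul, sub_mul, hPP]; simp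
      rw [add_mul, mul_add, mul_add, e1, e2, e3, e4]
      abel
    let K : Set (Matrix.GeneralLinearGroup (Fin n) ℝ) :=
      {g | g ∈ I ∧ (g : Matrix (Fin n) (Fin n) ℝ) * (1 - P) = 1 - P}
    have hKc : IsClosed K := by
      have c1 : IsClosed {g : Matrix.GeneralLinearGroup (Fin n) ℝ | g ∈ I} := by
        simp only [hI]
        exact (closed_inv μ).preimage Units.continuous_val
      exact c1.inter (isClosed_eq (Units.continuous_val.matrix_mul continuous_const)
        continuous_const)
    have hKinv : ∀ g ∈ K, g⁻¹ ∈ K := by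
      rintro g ⟨hg, h⟩
      refine ⟨I.inv_mem hg, ?_⟩
      conv_lhs => rw [← h]
      rw [← mul_assoc, ← Units.val_mul, inv_mul_cancel, Units.val_one, one_mul]
    have hKb : ∀ g ∈ K, ∀ i j, |(g : Matrix (Fin n) (Fin n) ℝ) i j| ≤ S + sz 1 (1 - P) :=
      fun g hg => entry_bound P _ S (hS _ ((hI g).1 hg.1)) hg.2
    have hKcomp : IsCompact K := compact_GL K hKc _ hKb (fun g hg => hKb _ (hKinv g hg))
    have hK' : IsCompact ((Subtype.val : I → _) ⁻¹' K) := by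
      rw [Subtype.isCompact_iff]
      convert hKcomp
      ext g
      constructor
      · rintro ⟨x, hx, rfl⟩
        exact hx
      · intro hg
        exact ⟨⟨g, hg.1⟩, hg, rfl⟩
    have him := hK'.image (f := (QuotientGroup.mk : I → I ⧸ J.subgroupOf I))
      continuous_quot_mk
    refine ⟨?_⟩
    convert him
    symm
    rw [Set.eq_univ_iff_forall]
    intro q
    obtain ⟨⟨g, hg⟩, rfl⟩ := QuotientGroup.mk_surjective q
    let k : Matrix.GeneralLinearGroup (Fin n) ℝ :=
      ⟨g * P + (1 - P), (g⁻¹ : Matrix.GeneralLinearGroup (Fin n) ℝ) * P + (1 - P),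
        hmul g hg _ (I.inv_mem hg) (mul_inv_cancel g),
        hmul _ (I.inv_mem hg) g hg (inv_mul_cancel g)⟩
    have hkval : (k : Matrix (Fin n) (Fin n) ℝ) = g * P + (1 - P) := rfl
    have hkg : ∀ x ∈ measureSupport μ, (k : Matrix (Fin n) (Fin n) ℝ).mulVec x
        = (g : Matrix (Fin n) (Fin n) ℝ).mulVec x := by
      intro x hx
      have := hP x (Submodule.subset_span hx)
      rw [hkval, Matrix.add_mulVec, ← Matrix.mulVec_mulVec, Matrix.sub_mulVec, this]
      simp
    have hkI : k ∈ I := by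
      rw [hI, map_eq_of_agree μ _ _ hkg, ← hI]
      exact hg
    refine ⟨⟨k, hkI⟩, ⟨hkI, ?_⟩, ?_⟩
    · rw [hkval, add_mul, mul_assoc, mul_sub, hPP, mul_one, sub_self, mul_zero, zero_add,
        mul_sub, sub_mul, sub_mul, hPP]
      simp
    · rw [QuotientGroup.eq, Subgroup.mem_subgroupOf]
      change k⁻¹ * g ∈ J
      rw [hJ]
      intro x hx
      rw [Units.val_mul, ← Matrix.mulVec_mulVec, ← hkg x hx, Matrix.mulVec_mulVec,
        ← Units.val_mul, inv_mul_cancel, Units.val_one, Matrix.one_mulVec]
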